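/- If a finite undirected graph G is obtained from a finite undirected graph H by deleting an edge ab, then the vertex-deleted graph H \ a is a subgraph of G, and consequently Ent(H \ a) ≤ Ent(G) and Ent(H) − 1 ≤ Ent(G). -/

import Mathlib

/-!
The entanglement game `Ent(G,k)` on a graph with adjacency relation
`E : V → V → Prop` is played by Robber against `k` cops.  Positions are
`(v, C, P)` with `v : V`, `C : Finset V` with `C.card ≤ k`, and
`P ∈ {Cops, Robber}`.  Initially Robber chooses `v₀` and moves to
`(v₀, ∅, Cops)`.  From `(v, C, Cops)`, Cops may skip, add a cop on `v`
(if at most `k` cops are then placed), or move a placed cop to `v`; from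
`(v, C, Robber)`, Robber moves along an edge to a vertex free of cops.
Every finite play is a win for Cops, so "Cops have a winning strategy from
`(v, C, Cops)`" is the inductive predicate `EntCopsWinFrom`.  The
entanglement of the graph is the least `k` such that Cops have a winning
strategy in `Ent(G,k)` (it is at most the number of vertices).
-/

variable {V : Type*} [DecidableEq V]

/-- A legal Cops move in the game `Ent(G,k)`: from position `(v, C, Cops)`
Cops may go to `(v, C', Robber)` where `C'` is `C` (skip), `C ∪ {v}` provided
at most `k` cops are used (add), or `(C \ {x}) ∪ {v}` for some `x ∈ C`
(move a placed cop). -/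
def EntCopsMove (k : ℕ) (v : V) (C C' : Finset V) : Prop :=
  C' = C ∨ (C' = insert v C ∧ (insert v C).card ≤ k) ∨
    ∃ x ∈ C, C' = insert v (C.erase x)

/-- Cops have a winning strategy in `Ent(G,k)` from position `(v, C, Cops)`. -/
inductive EntCopsWinFrom (E : V → V → Prop) (k : ℕ) : V → Finset V → Prop
  | step (v : V) (C C' : Finset V) (hmove : EntCopsMove k v C C')
      (h : ∀ v', E v v' → v' ∉ C' → EntCopsWinFrom E k v' C') :
      EntCopsWinFrom E k v C

/-- Cops have a winning strategy in the game `Ent(G,k)`. -/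
def EntCopsWin (E : V → V → Prop) (k : ℕ) : Prop :=
  ∀ v : V, EntCopsWinFrom E k v ∅

/-- The entanglement of a graph: the least number `k` of cops such that Cops
have a winning strategy in the game `Ent(G,k)`. -/
noncomputable def entanglement (E : V → V → Prop) : ℕ :=
  sInf {k | EntCopsWin E k}

section Game

variable {W : Type*} [DecidableEq W]

theorem EntCopsMove.map (φ : W ↪ V) {k : ℕ} {v : W} {C C' : Finset W}
    (h : EntCopsMove k v C C') : EntCopsMove k (φ v) (C.map φ) (C'.map φ) := by
  rcases h with rfl | ⟨rfl, hc⟩ | ⟨x, hx, rfl⟩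
  · exact Or.inl rfl
  · refine Or.inr (Or.inl ⟨Finset.map_insert .., ?_⟩)
    rwa [← Finset.map_insert, Finset.card_map]
  · refine Or.inr (Or.inr ⟨φ x, Finset.mem_map_of_mem φ hx, ?_⟩)
    rw [Finset.map_insert, Finset.map_erase]

theorem EntCopsMove.exists_of_map (φ : W ↪ V) {k : ℕ} {v : W} {C : Finset W} {D : Finset V}
    (h : EntCopsMove k (φ v) (C.map φ) D) :
    ∃ C', D = C'.map φ ∧ EntCopsMove k v C C' := by
  rcases h with rfl | ⟨rfl, hc⟩ | ⟨x, hx, rfl⟩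
  · exact ⟨C, rfl, Or.inl rfl⟩
  · rw [← Finset.map_insert, Finset.card_map] at hc
    exact ⟨insert v C, (Finset.map_insert ..).symm, Or.inr (Or.inl ⟨rfl, hc⟩)⟩
  · obtain ⟨y, hy, rfl⟩ := Finset.mem_map.1 hx
    exact ⟨insert v (C.erase y), by rw [Finset.map_insert, Finset.map_erase],
      Or.inr (Or.inr ⟨y, hy, rfl⟩)⟩

theorem EntCopsMove.mono {k l : ℕ} (hkl : k ≤ l) {v : V} {C C' : Finset V}
    (h : EntCopsMove k v C C') : EntCopsMove l v C C' :=
  h.imp_right (Or.imp_left (And.imp_right (le_trans · hkl)))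

theorem EntCopsMove.card_le {k : ℕ} {v : V} {C C' : Finset V}
    (h : EntCopsMove k v C C') (hC : C.card ≤ k) : C'.card ≤ k := by
  rcases h with rfl | ⟨rfl, hc⟩ | ⟨x, hx, rfl⟩
  · exact hC
  · exact hc
  · exact (Finset.card_insert_le _ _).trans ((Finset.card_erase_add_one hx).trans_le hC)

/-- A move remains available when a further cop, idle on `a`, is added to the team. -/
theorem EntCopsMove.insert_idle {k : ℕ} {v a : V} {C C' : Finset V}
    (h : EntCopsMove k v C C') (ha : a ∉ C) :
    EntCopsMove (k + 1) v (insert a C) (insert a C') := by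
  rcases h with rfl | ⟨rfl, hc⟩ | ⟨x, hx, rfl⟩
  · exact Or.inl rfl
  · refine Or.inr (Or.inl ⟨Finset.insert_comm .., ?_⟩)
    rw [Finset.insert_comm]
    exact (Finset.card_insert_le _ _).trans (by omega)
  · refine Or.inr (Or.inr ⟨x, Finset.mem_insert_of_mem hx, ?_⟩)
    have hax : a ≠ x := fun h => ha (h ▸ hx)
    rw [Finset.erase_insert_of_ne hax, Finset.insert_comm]

/-- Cops occupying a larger set of vertices can imitate every move. -/
theorem EntCopsMove.exists_superset {k : ℕ} {v : V} {C C' D : Finset V}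
    (h : EntCopsMove k v C C') (hCD : C ⊆ D) (hD : D.card ≤ k) :
    ∃ D', EntCopsMove k v D D' ∧ C' ⊆ D' := by
  rcases h with rfl | ⟨rfl, hc⟩ | ⟨x, hx, rfl⟩
  · exact ⟨D, Or.inl rfl, hCD⟩
  · by_cases hi : (insert v D).card ≤ k
    · exact ⟨insert v D, Or.inr (Or.inl ⟨rfl, hi⟩), Finset.insert_subset_insert v hCD⟩
    · have hv : v ∉ D := fun hv => hi (by rwa [Finset.insert_eq_of_mem hv])
      rw [Finset.card_insert_of_notMem hv] at hi
      rw [Finset.card_insert_of_notMem fun h => hv (hCD h)] at hc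
      obtain ⟨x, hxD, hxC⟩ := Finset.exists_mem_notMem_of_card_lt_card
        (show C.card < D.card by omega)
      exact ⟨insert v (D.erase x), Or.inr (Or.inr ⟨x, hxD, rfl⟩),
        Finset.insert_subset_insert v (Finset.subset_erase.2 ⟨hCD, hxC⟩)⟩
  · exact ⟨insert v (D.erase x), Or.inr (Or.inr ⟨x, hCD hx, rfl⟩),
      Finset.insert_subset_insert v (Finset.erase_subset_erase x hCD)⟩

theorem EntCopsWinFrom.comap {E : W → W → Prop} {F : V → V → Prop} (φ : W ↪ V)
    (hφ : ∀ u v, E u v → F (φ u) (φ v)) {k : ℕ} {x : V} {D : Finset V}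
    (h : EntCopsWinFrom F k x D) :
    ∀ v C, x = φ v → D = C.map φ → EntCopsWinFrom E k v C := by
  induction h with
  | step x D D' hmove _ ih =>
    rintro v C rfl rfl
    obtain ⟨C', rfl, hC'⟩ := hmove.exists_of_map φ
    exact .step v C C' hC' fun v' hv' hn =>
      ih (φ v') (hφ _ _ hv') (by simpa using hn) v' C' rfl rfl

theorem EntCopsWin.comap {E : W → W → Prop} {F : V → V → Prop} (φ : W ↪ V)
    (hφ : ∀ u v, E u v → F (φ u) (φ v)) {k : ℕ} (h : EntCopsWin F k) : EntCopsWin E k :=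
  fun v => (h (φ v)).comap φ hφ v ∅ rfl (Finset.map_empty φ).symm

theorem entCopsWinFrom_card [Fintype V] (E : V → V → Prop) (C : Finset V) :
    ∀ v ∉ C, EntCopsWinFrom E (Fintype.card V) v C := by
  induction C using WellFoundedGT.induction with
  | ind C ih =>
    intro v hv
    exact .step v C (insert v C) (Or.inr (Or.inl ⟨rfl, Finset.card_le_univ _⟩)) fun v' _ hn =>
      ih (insert v C) (Finset.ssubset_insert hv) v' hn

/-- The infimum defining the entanglement of a finite graph is attained. -/
theorem entCopsWin_entanglement [Fintype V] (E : V → V → Prop) :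
    EntCopsWin E (entanglement E) :=
  Nat.sInf_mem (s := {k | EntCopsWin E k})
    ⟨Fintype.card V, fun v => entCopsWinFrom_card E ∅ v (Finset.notMem_empty v)⟩

theorem entanglement_le {E : V → V → Prop} {k : ℕ} (h : EntCopsWin E k) : entanglement E ≤ k :=
  Nat.sInf_le h

theorem entanglement_le_of_embedding [Fintype V] {E : W → W → Prop} {F : V → V → Prop}
    (φ : W ↪ V) (hφ : ∀ u v, E u v → F (φ u) (φ v)) : entanglement E ≤ entanglement F :=
  entanglement_le ((entCopsWin_entanglement F).comap φ hφ)

section VertexDeletion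

variable {H : SimpleGraph V} {a : V} {k : ℕ}

/-- Once a cop sits on `a`, a winning strategy on `H \ a` may be followed in `H`. -/
theorem EntCopsWinFrom.of_induce_of_mem {v : ({a}ᶜ : Set V)} {C : Finset ({a}ᶜ : Set V)}
    (h : EntCopsWinFrom (H.induce ({a}ᶜ : Set V)).Adj k v C) :
    ∀ D : Finset V, insert a (C.map (Function.Embedding.subtype _)) ⊆ D → D.card ≤ k + 1 →
      EntCopsWinFrom H.Adj (k + 1) v D := by
  induction h with
  | step v C C' hmove _ ih =>
    intro D hCD hD
    obtain ⟨D', hmove', hsub⟩ :=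
      ((hmove.map (Function.Embedding.subtype _)).insert_idle
        (a := a) (by simp)).exists_superset hCD hD
    refine .step _ D D' hmove' fun v' hadj hv' => ?_
    have hne : v' ∈ ({a}ᶜ : Set V) := by
      rintro rfl
      exact hv' (hsub (Finset.mem_insert_self _ _))
    refine ih ⟨v', hne⟩ hadj (fun hmem => hv' (hsub (Finset.mem_insert_of_mem ?_))) D' hsub
      (hmove'.card_le hD)
    exact Finset.mem_map_of_mem (Function.Embedding.subtype _) hmem

theorem EntCopsWin.winFrom_deleted_vertex (h : EntCopsWin (H.induce ({a}ᶜ : Set V)).Adj k)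
    {C : Finset V} (hC : C.card ≤ k) : EntCopsWinFrom H.Adj (k + 1) a C := by
  have hcard : (insert a C).card ≤ k + 1 := (Finset.card_insert_le _ _).trans (by omega)
  refine .step a C (insert a C) (Or.inr (Or.inl ⟨rfl, hcard⟩)) fun v' hadj _ => ?_
  exact (h ⟨v', hadj.ne'⟩).of_induce_of_mem (insert a C) (by simp) hcard

theorem EntCopsWinFrom.of_induce (hwin : EntCopsWin (H.induce ({a}ᶜ : Set V)).Adj k)
    {v : ({a}ᶜ : Set V)} {C : Finset ({a}ᶜ : Set V)}
    (h : EntCopsWinFrom (H.induce ({a}ᶜ : Set V)).Adj k v C) (hC : C.card ≤ k) :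
    EntCopsWinFrom H.Adj (k + 1) v (C.map (Function.Embedding.subtype _)) := by
  induction h with
  | step v C C' hmove _ ih =>
    have hC' := hmove.card_le hC
    refine .step _ _ (C'.map (Function.Embedding.subtype _))
      ((hmove.map (Function.Embedding.subtype _)).mono k.le_succ) fun v' hadj hv' => ?_
    by_cases hva : v' = a
    · subst hva
      exact hwin.winFrom_deleted_vertex (by rwa [Finset.card_map])
    · exact ih ⟨v', hva⟩ hadj
        (fun hmem => hv' (Finset.mem_map_of_mem (Function.Embedding.subtype _) hmem)) hC'

/-- One additional cop compensates for the presence of the vertex `a`. -/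
theorem EntCopsWin.of_induce_compl_singleton
    (h : EntCopsWin (H.induce ({a}ᶜ : Set V)).Adj k) : EntCopsWin H.Adj (k + 1) := by
  intro v
  by_cases hva : v = a
  · subst hva
    exact h.winFrom_deleted_vertex (Nat.zero_le k)
  · simpa using (h ⟨v, hva⟩).of_induce h (Nat.zero_le k)

theorem entanglement_le_induce_compl_singleton_add_one [Fintype V] (H : SimpleGraph V) (a : V) :
    entanglement H.Adj ≤ entanglement (H.induce ({a}ᶜ : Set V)).Adj + 1 :=
  entanglement_le (entCopsWin_entanglement _).of_induce_compl_singleton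

end VertexDeletion

end Game

/-- If the finite graph `G` is obtained from the finite graph `H` by deleting
an edge `ab`, then the vertex-deleted graph `H \ a` is a subgraph of `G`
(there is an injective graph homomorphism of `H \ a` into `G`), and
consequently `Ent(H \ a) ≤ Ent(G)` and `Ent(H) - 1 ≤ Ent(G)`. -/
theorem deleteEdge_vertexDeleted_subgraph {V : Type*} [Fintype V]
    [DecidableEq V] (H G : SimpleGraph V) (a b : V) (hab : H.Adj a b)
    (hG : G = H.deleteEdges {s(a, b)}) :
    (∃ φ : H.induce ({a}ᶜ : Set V) →g G, Function.Injective φ) ∧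
    entanglement (H.induce ({a}ᶜ : Set V)).Adj ≤ entanglement G.Adj ∧
    entanglement H.Adj - 1 ≤ entanglement G.Adj := by
  have hadj : ∀ u v : ({a}ᶜ : Set V), (H.induce ({a}ᶜ : Set V)).Adj u v → G.Adj u v := by
    intro u v huv
    have hu : (u : V) ≠ a := u.2
    have hv : (v : V) ≠ a := v.2
    rw [hG, SimpleGraph.deleteEdges_adj]
    refine ⟨huv, ?_⟩
    simp [hu, hv]
  have hle := entanglement_le_of_embedding (Function.Embedding.subtype _) hadj
  refine ⟨⟨⟨Subtype.val, hadj _ _⟩, Subtype.val_injective⟩, hle, ?_⟩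
  have := entanglement_le_induce_compl_singleton_add_one H a
  omega
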